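/- The orientation of the path on 22 vertices v₁, v₂, …, v₂₂ in which the arcs alternate in the same pattern as the alternating orientation of the 10-path (that is, the arc set is {v₁→v₂, v₃→v₂, v₃→v₄, v₅→v₄, …, v₂₁→v₂₀, v₂₁→v₂₂}, with v_{2k+1}→v_{2k} and v_{2k+1}→v_{2k+2} for each applicable k) is not (2,3)-cordial. -/

import Mathlib

open Finset

variable {V : Type*} [Fintype V] [DecidableEq V]

/-- The label induced on an arc `a = (u, v)` by a vertex labeling `f : V → {0,1}`:
`g(u→v) = f(v) - f(u)`. -/
def arcLabel (f : V → Fin 2) (a : V × V) : ℤ := ((f a.2 : ℕ) : ℤ) - ((f a.1 : ℕ) : ℤ)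

/-- The number of arcs of `A` receiving induced label `i`. -/
def labelCount (A : Finset (V × V)) (f : V → Fin 2) (i : ℤ) : ℕ :=
  (A.filter fun a => arcLabel f a = i).card

/-- A vertex labeling `f : V → {0,1}` is friendly if the number of vertices labeled `0`
and the number labeled `1` differ by at most `1`. -/
def Friendly (f : V → Fin 2) : Prop :=
  |((univ.filter fun v => f v = 0).card : ℤ) - ((univ.filter fun v => f v = 1).card : ℤ)| ≤ 1

/-- A digraph (given by its arc set `A`) is (2,3)-cordial if there is a friendly vertex
labeling whose induced arc labeling `g` satisfies
`-1 ≤ |g⁻¹(i)| - |g⁻¹(j)| ≤ 1` for all `i, j ∈ {-1, 0, 1}`. -/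
def Cordial (A : Finset (V × V)) : Prop :=
  ∃ f : V → Fin 2, Friendly f ∧
    ∀ i ∈ ({-1, 0, 1} : Finset ℤ), ∀ j ∈ ({-1, 0, 1} : Finset ℤ),
      -1 ≤ (labelCount A f i : ℤ) - (labelCount A f j : ℤ) ∧
        (labelCount A f i : ℤ) - (labelCount A f j : ℤ) ≤ 1

/-- The alternating orientation of the path on 22 vertices `v₁, …, v₂₂` (here
`vᵢ` is `i - 1 : Fin 22`), with arcs `v₁→v₂` and `v_{2k+1}→v_{2k}`,
`v_{2k+1}→v_{2k+2}` for each applicable `k`. -/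
def altPath22 : Finset (Fin 22 × Fin 22) :=
  {(0, 1), (2, 1), (2, 3), (4, 3), (4, 5), (6, 5), (6, 7), (8, 7), (8, 9),
   (10, 9), (10, 11), (12, 11), (12, 13), (14, 13), (14, 15), (16, 15), (16, 17),
   (18, 17), (18, 19), (20, 19), (20, 21)}

/-- An induced arc label is `-1`, `0` or `1`. -/
theorem arcLabel_eq_neg_one_or_zero_or_one {W : Type*} (f : W → Fin 2) (a : W × W) :
    arcLabel f a = -1 ∨ arcLabel f a = 0 ∨ arcLabel f a = 1 := by
  unfold arcLabel
  omega

/-- Every arc is counted by exactly one of the three labels. -/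
theorem labelCount_add_labelCount_add_labelCount {W : Type*} (A : Finset (W × W)) (f : W → Fin 2) :
    labelCount A f (-1) + labelCount A f 0 + labelCount A f 1 = A.card := by
  rw [card_eq_sum_ones A]
  simp only [labelCount, card_filter, ← sum_add_distrib]
  refine sum_congr rfl fun a _ => ?_
  rcases arcLabel_eq_neg_one_or_zero_or_one f a with h | h | h <;> simp [h]

/-- The sum of all arc labels is the number of labels `1` minus the number of labels `-1`. -/
theorem sum_arcLabel {W : Type*} (A : Finset (W × W)) (f : W → Fin 2) :
    ∑ a ∈ A, arcLabel f a = (labelCount A f 1 : ℤ) - labelCount A f (-1) := by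
  simp only [labelCount, card_filter, Nat.cast_sum, ← sum_sub_distrib]
  refine sum_congr rfl fun a _ => ?_
  rcases arcLabel_eq_neg_one_or_zero_or_one f a with h | h | h <;> simp [h]

/-- A friendly labeling satisfies `|2 ∑ f(v) - |W|| ≤ 1`. -/
theorem Friendly.abs_two_mul_sum_sub_card_le {W : Type*} [Fintype W] {f : W → Fin 2} (hf : Friendly f) :
    |2 * ∑ v, ((f v : ℕ) : ℤ) - Fintype.card W| ≤ 1 := by
  have h : ((univ.filter fun v => f v = 0).card : ℤ) - (univ.filter fun v => f v = 1).card =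
      Fintype.card W - 2 * ∑ v, ((f v : ℕ) : ℤ) := by
    rw [← card_univ, card_eq_sum_ones univ]
    simp only [card_filter, Nat.cast_sum, mul_sum, ← sum_sub_distrib]
    refine sum_congr rfl fun v _ => ?_
    generalize f v = x
    fin_cases x <;> simp
  rw [abs_sub_comm, ← h]
  exact hf

/-- The alternating orientation of the path on 22 vertices is not (2,3)-cordial. -/
theorem altPath22_not_cordial : ¬ Cordial altPath22 := by
  rintro ⟨f, hf, hA⟩
  have hcard := labelCount_add_labelCount_add_labelCount altPath22 f
  rw [show altPath22.card = 21 from by decide] at hcard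
  have h₁ := hA (-1) (by simp) 0 (by simp)
  have h₂ := hA 0 (by simp) 1 (by simp)
  have h₃ := hA (-1) (by simp) 1 (by simp)
  have hsum : ∑ a ∈ altPath22, arcLabel f a = 0 := by
    rw [sum_arcLabel]
    omega
  have hf' := abs_le.1 hf.abs_two_mul_sum_sub_card_le
  simp only [Fin.sum_univ_succ, Fintype.card_fin] at hf'
  simp [altPath22, arcLabel] at hsum hf'
  have h_ends : (f 0 : ℕ) = f 21 := by omega
  omega
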